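/- None of the étale phrases P^{1,1;l₁,l₂}_a, P^{3;l}_a (with a ≠ τ(a)), P^{2,1;l₁,l₂}_a, P^{1,2;l₁,l₂}_a, P^{1,1,1;l₁,l₂,l₃}_a is homotopic to the empty phrase (∅)_k. -/

import Mathlib

namespace Nano

variable {α : Type*}

/-- A letter: an identifier together with its projection to the alphabet `α`. -/
abbrev Letter (α : Type*) := ℕ × α

/-- The projection of a letter. -/
def proj (A : Letter α) : α := A.2

/-- A phrase: a finite sequence of words, each word a list of letters. -/
abbrev Phrase (α : Type*) := List (List (Letter α))

/-- Flatten a phrase into one list, separating components by `none` (the `|` character). -/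
def flat (P : Phrase α) : List (Option (Letter α)) :=
  List.intercalate [none] (P.map fun w => w.map some)

/-- The `i`-th component (word) of a phrase (0-indexed). -/
def comp (P : Phrase α) (i : ℕ) : List (Letter α) := P.getD i []

/-- A phrase is a Gauss phrase if every letter occurring in it occurs exactly twice. -/
def IsGauss [DecidableEq α] (P : Phrase α) : Prop :=
  ∀ A ∈ P.flatten, P.flatten.count A = 2

/-- All letters of `P` project into the subset `β` of `α`. -/
def ProjIn (β : Set α) (P : Phrase α) : Prop := ∀ A ∈ P.flatten, A.2 ∈ β

/-- Renaming of letters (injective renamings give isomorphisms of `α`-alphabets,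
preserving the projection). -/
def rename (f : ℕ → ℕ) (P : Phrase α) : Phrase α :=
  P.map (List.map fun A => (f A.1, A.2))

/-- One elementary step: an isomorphism or one of the homotopy moves (1)-(3),
for the involution `τ` on `α`. -/
inductive Move (τ : α → α) : Phrase α → Phrase α → Prop
  | iso (f : ℕ → ℕ) (hf : Function.Injective f) (P : Phrase α) :
      Move τ P (rename f P)
  | h1 (P Q : Phrase α) (A : Letter α) (x y : List (Option (Letter α)))
      (hP : flat P = x ++ [some A, some A] ++ y)
      (hQ : flat Q = x ++ y) : Move τ P Q
  | h2 (P Q : Phrase α) (A B : Letter α) (x y z : List (Option (Letter α)))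
      (hAB : B.2 = τ A.2)
      (hP : flat P = x ++ [some A, some B] ++ y ++ [some B, some A] ++ z)
      (hQ : flat Q = x ++ y ++ z) : Move τ P Q
  | h3 (P Q : Phrase α) (A B C : Letter α) (x y z t : List (Option (Letter α)))
      (hAB : A.2 = B.2) (hBC : B.2 = C.2)
      (hP : flat P = x ++ [some A, some B] ++ y ++ [some A, some C] ++ z
              ++ [some B, some C] ++ t)
      (hQ : flat Q = x ++ [some B, some A] ++ y ++ [some C, some A] ++ z
              ++ [some C, some B] ++ t) : Move τ P Q

/-- A nanophrase over the subset `β`: a Gauss phrase all of whose letters project into `β`. -/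
def NanoIn [DecidableEq α] (β : Set α) (P : Phrase α) : Prop := IsGauss P ∧ ProjIn β P

/-- Homotopy of nanophrases in the class of nanophrases over `β ⊆ α`:
a finite chain of isomorphisms, moves (1)-(3) and their inverses, all whose
terms are nanophrases over `β`. -/
def HomotopicIn [DecidableEq α] (τ : α → α) (β : Set α) (P Q : Phrase α) : Prop :=
  Relation.ReflTransGen
    (fun X Y => (Move τ X Y ∨ Move τ Y X) ∧ NanoIn β X ∧ NanoIn β Y) P Q

/-- Homotopy of nanophrases over `α`. -/
def Homotopic [DecidableEq α] (τ : α → α) (P Q : Phrase α) : Prop :=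
  HomotopicIn τ Set.univ P Q

/-! ### Desingularization -/

/-- The letter `A_{p,q}` of the desingularized alphabet. -/
def dLetter (A : Letter α) (p q : ℕ) : Letter α := (Nat.pair A.1 (Nat.pair p q), A.2)

/-- The replacement of the `i`-th occurrence (1-indexed) of a letter `A` of
multiplicity `m`: `A_{1,i} A_{2,i} ⋯ A_{i-1,i} A_{i,i+1} ⋯ A_{i,m}`. -/
def repl (A : Letter α) (i m : ℕ) : List (Letter α) :=
  ((List.range (i - 1)).map fun j => dLetter A (j + 1) i) ++
  ((List.range (m - i)).map fun j => dLetter A i (i + j + 1))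

def desingWord [DecidableEq α] (m : Letter α → ℕ) :
    List (Letter α) → (Letter α → ℕ) → List (Letter α)
  | [], _ => []
  | A :: rest, seen =>
      repl A (seen A + 1) (m A) ++
        desingWord m rest (fun B => if B = A then seen B + 1 else seen B)

def desingAux [DecidableEq α] (m : Letter α → ℕ) :
    Phrase α → (Letter α → ℕ) → Phrase α
  | [], _ => []
  | w :: ws, seen => desingWord m w seen :: desingAux m ws (fun B => seen B + w.count B)

/-- The desingularization `P^d` of an étale phrase `P`. -/
def desing [DecidableEq α] (P : Phrase α) : Phrase α :=
  desingAux (fun A => P.flatten.count A) P (fun _ => 0)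

/-- Homotopy of étale phrases: homotopy of their desingularizations. -/
def EHomotopic [DecidableEq α] (τ : α → α) (P Q : Phrase α) : Prop :=
  Homotopic τ (desing P) (desing Q)

/-! ### Phrases over `α` itself, via the identity projection -/

/-- An element of `α` regarded as a letter (identity projection). -/
def ofα (a : α) : Letter α := (0, a)

/-- The empty phrase `(∅)_k` of length `k`. -/
def emptyP (k : ℕ) : Phrase α := List.replicate k []

/-- `P^{1,1;l₁,l₂}_a`. -/
def P11 (k : ℕ) (l1 l2 : Fin k) (a : α) : Phrase α :=
  List.ofFn fun i => if i = l1 ∨ i = l2 then [ofα a] else []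

/-- `P^{3;l}_a`. -/
def P3 (k : ℕ) (l : Fin k) (a : α) : Phrase α :=
  List.ofFn fun i => if i = l then [ofα a, ofα a, ofα a] else []

/-- `P^{2,1;l₁,l₂}_a`. -/
def P21 (k : ℕ) (l1 l2 : Fin k) (a : α) : Phrase α :=
  List.ofFn fun i => if i = l1 then [ofα a, ofα a] else if i = l2 then [ofα a] else []

/-- `P^{1,2;l₁,l₂}_a`. -/
def P12 (k : ℕ) (l1 l2 : Fin k) (a : α) : Phrase α :=
  List.ofFn fun i => if i = l1 then [ofα a] else if i = l2 then [ofα a, ofα a] else []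

/-- `P^{1,1,1;l₁,l₂,l₃}_a`. -/
def P111 (k : ℕ) (l1 l2 l3 : Fin k) (a : α) : Phrase α :=
  List.ofFn fun i => if i = l1 ∨ i = l2 ∨ i = l3 then [ofα a] else []


/-! ### The model phrases, indexed by their type and indices -/

/-- An index for the model phrases `P^{1,1;l₁,l₂}_a`, `P^{3;l}_a`, `P^{2,1;l₁,l₂}_a`,
`P^{1,2;l₁,l₂}_a`, `P^{1,1,1;l₁,l₂,l₃}_a` of length `k`. -/
inductive Model (k : ℕ) (α : Type*) where
  | m11 (l1 l2 : Fin k) (a : α)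
  | m3 (l : Fin k) (a : α)
  | m21 (l1 l2 : Fin k) (a : α)
  | m12 (l1 l2 : Fin k) (a : α)
  | m111 (l1 l2 l3 : Fin k) (a : α)

variable {k : ℕ}

/-- Admissibility: the indices are strictly increasing, and `a ≠ τ(a)` for `P^{3;l}_a`. -/
def Model.valid (τ : α → α) : Model k α → Prop
  | .m11 l1 l2 _ => l1 < l2
  | .m3 _ a => a ≠ τ a
  | .m21 l1 l2 _ => l1 < l2
  | .m12 l1 l2 _ => l1 < l2
  | .m111 l1 l2 l3 _ => l1 < l2 ∧ l2 < l3

/-- The étale phrase indexed by a model index. -/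
def Model.toPhrase : Model k α → Phrase α
  | .m11 l1 l2 a => P11 k l1 l2 a
  | .m3 l a => P3 k l a
  | .m21 l1 l2 a => P21 k l1 l2 a
  | .m12 l1 l2 a => P12 k l1 l2 a
  | .m111 l1 l2 l3 a => P111 k l1 l2 l3 a

/-- The letter of `α` used by a model phrase. -/
def Model.letter : Model k α → α
  | .m11 _ _ a => a
  | .m3 _ a => a
  | .m21 _ _ a => a
  | .m12 _ _ a => a
  | .m111 _ _ _ a => a

section Words

variable {β : Type*}

/-- The number of pairs of positions `p < q` of `w`, weighted by `s (w p) * (1 - s (w q))`. -/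
def inversions (s : β → ZMod 2) : List β → ZMod 2
  | [] => 0
  | A :: w => s A * (w.map fun E => 1 - s E).sum + inversions s w

theorem inversions_append (s : β → ZMod 2) (u v : List β) :
    inversions s (u ++ v) = inversions s u
      + (u.map s).sum * (v.map fun E => 1 - s E).sum + inversions s v := by
  induction u with
  | nil => simp [inversions]
  | cons A u ih => simp [inversions, ih]; ring

theorem inversions_congr {s s' : β → ZMod 2} {w : List β} (h : ∀ A ∈ w, s A = s' A) :
    inversions s w = inversions s' w := by
  induction w with
  | nil => rfl
  | cons A w ih =>
    simp only [List.mem_cons, forall_eq_or_imp] at h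
    have : (w.map fun E => 1 - s E) = w.map fun E => 1 - s' E :=
      List.map_congr_left fun E hE => by rw [h.2 E hE]
    rw [inversions, inversions, h.1, ih h.2, this]

theorem inversions_map {γ : Type*} (g : β → γ) (s : γ → ZMod 2) (w : List β) :
    inversions s (w.map g) = inversions (s ∘ g) w := by
  induction w with
  | nil => rfl
  | cons A w ih => simp [inversions, ih, Function.comp_def]

variable [DecidableEq β]

/-- The number of pairs of positions `p < q` of `w` carrying `D` and `E` respectively. -/
def pairCount (D E : β) : List β → ℕ
  | [] => 0
  | c :: w => (if c = D then w.count E else 0) + pairCount D E w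

theorem pairCount_append (D E : β) (u v : List β) :
    pairCount D E (u ++ v) = pairCount D E u + u.count D * v.count E + pairCount D E v := by
  induction u with
  | nil => simp [pairCount]
  | cons c u ih =>
    by_cases h : c = D
    · simp [pairCount, ih, h]
      ring
    · simp [pairCount, ih, h]

theorem pairCount_eq_zero_left {D : β} (E : β) {w : List β} (h : D ∉ w) :
    pairCount D E w = 0 := by
  induction w with
  | nil => rfl
  | cons c w ih =>
    simp only [List.mem_cons, not_or] at h
    simp [pairCount, ih h.2, Ne.symm h.1]

theorem pairCount_eq_zero_right (D : β) {E : β} {w : List β} (h : E ∉ w) :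
    pairCount D E w = 0 := by
  induction w with
  | nil => rfl
  | cons c w ih =>
    simp only [List.mem_cons, not_or] at h
    simp [pairCount, ih h.2, List.count_eq_zero_of_not_mem h.2]

theorem pairCount_map {γ : Type*} [DecidableEq γ] {g : β → γ} (hg : Function.Injective g)
    (D E : β) (w : List β) : pairCount (g D) (g E) (w.map g) = pairCount D E w := by
  induction w with
  | nil => rfl
  | cons c w ih => simp [pairCount, ih, hg.eq_iff, List.count_map_of_injective _ _ hg]

/-- The sign of the interlacement of `D` and `E` in a Gauss word: `1` for the pattern `DEDE`,
`-1` for `EDED`, and `0` otherwise. -/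
def interlace (w : List β) (D E : β) : ℤ :=
  if D = E then 0 else if pairCount D E w = 3 then 1 else if pairCount D E w = 1 then -1 else 0

theorem interlace_congr {γ : Type*} [DecidableEq γ] {w : List β} {w' : List γ} {D E : β}
    {D' E' : γ} (hD : D = E ↔ D' = E')
    (h : pairCount D E w = pairCount D' E' w') : interlace w D E = interlace w' D' E' := by
  simp only [interlace, hD, h]

theorem interlace_eq_zero {w : List β} {D E : β} (h : Even (pairCount D E w)) :
    interlace w D E = 0 := by
  unfold interlace
  split_ifs with h₁ h₂ h₃
  · rfl
  · rw [h₂] at h; exact absurd h (by decide)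
  · rw [h₃] at h; exact absurd h (by decide)
  · rfl

@[simp] theorem interlace_self (w : List β) (D : β) : interlace w D D = 0 := by simp [interlace]

/-- The linking number of the letter `D` with the other letters of `w`, weighted by `h`. -/
def linking (h : β → ℤ) (w : List β) (D : β) : ℤ :=
  ∑ E ∈ w.toFinset, h E * interlace w D E

/-- The weighted sum of the squares of the linking numbers of the letters of `w`. -/
def selfLinking (h : β → ℤ) (w : List β) : ℤ :=
  ∑ D ∈ w.toFinset, h D * linking h w D ^ 2

theorem selfLinking_map {γ : Type*} [DecidableEq γ] {g : β → γ} (hg : Function.Injective g)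
    (h : γ → ℤ) (w : List β) : selfLinking h (w.map g) = selfLinking (h ∘ g) w := by
  have hS : (w.map g).toFinset = w.toFinset.image g := by ext; simp
  have hl (D : β) : linking h (w.map g) (g D) = linking (h ∘ g) w D := by
    unfold linking
    rw [hS, Finset.sum_image hg.injOn]
    refine Finset.sum_congr rfl fun E _ => ?_
    rw [interlace_congr (hg.eq_iff) (pairCount_map hg D E w), Function.comp]
  unfold selfLinking
  rw [hS, Finset.sum_image hg.injOn]
  simp [hl]

/-- Every letter occurring in the word `w` occurs exactly twice. -/
def IsGaussWord (w : List β) : Prop := ∀ D ∈ w, w.count D = 2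

theorem selfLinking_remove_one (h : β → ℤ) {A : β} {x y : List β}
    (hw : IsGaussWord (x ++ [A, A] ++ y)) :
    selfLinking h (x ++ [A, A] ++ y) = selfLinking h (x ++ y) := by
  have hA := hw A (by simp)
  simp only [List.count_append, List.count_cons_self, List.count_nil] at hA
  have hx : A ∉ x := List.count_eq_zero.1 (by omega)
  have hy : A ∉ y := List.count_eq_zero.1 (by omega)
  have hS : (x ++ [A, A] ++ y).toFinset = insert A (x ++ y).toFinset := by
    ext; simp
  have hn : A ∉ (x ++ y).toFinset := by simp [hx, hy]
  have hAE (E : β) : interlace (x ++ [A, A] ++ y) A E = 0 := by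
    by_cases hE : A = E
    · simp [hE]
    · apply interlace_eq_zero
      simp [pairCount_append, pairCount_eq_zero_left, hx, hy, pairCount, hE,
        List.count_eq_zero_of_not_mem]
  have hDA (D : β) : interlace (x ++ [A, A] ++ y) D A = 0 := by
    by_cases hD : A = D
    · simp [hD]
    · apply interlace_eq_zero
      simp [pairCount_append, pairCount_eq_zero_right, hx, hy, pairCount, hD,
        List.count_eq_zero_of_not_mem]
  have hDE {D E : β} (hD : A ≠ D) (hE : A ≠ E) :
      interlace (x ++ [A, A] ++ y) D E = interlace (x ++ y) D E := by
    refine interlace_congr Iff.rfl ?_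
    simp [pairCount_append, pairCount, hD, hE]
  have hl {D : β} (hD : A ≠ D) : linking h (x ++ [A, A] ++ y) D = linking h (x ++ y) D := by
    unfold linking
    rw [hS, Finset.sum_insert hn, hDA, mul_zero, zero_add]
    exact Finset.sum_congr rfl fun E hE => by rw [hDE hD (ne_of_mem_of_not_mem hE hn).symm]
  unfold selfLinking
  rw [hS, Finset.sum_insert hn]
  have : linking h (x ++ [A, A] ++ y) A = 0 :=
    Finset.sum_eq_zero fun E _ => by rw [hAE, mul_zero]
  rw [this]
  simp only [ne_eq, OfNat.ofNat_ne_zero, not_false_eq_true, zero_pow, mul_zero, zero_add]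
  exact Finset.sum_congr rfl fun D hD => by rw [hl (ne_of_mem_of_not_mem hD hn).symm]

theorem notMem_of_remove_two {A B : β} {x y z : List β}
    (hw : IsGaussWord (x ++ [A, B] ++ y ++ [B, A] ++ z)) :
    A ≠ B ∧ A ∉ x ++ y ++ z ∧ B ∉ x ++ y ++ z := by
  have hA := hw A (by simp)
  have hB := hw B (by simp)
  have hAB : A ≠ B := by
    rintro rfl
    simp only [List.count_append, List.count_cons_self, List.count_nil] at hA
    omega
  refine ⟨hAB, ?_, ?_⟩ <;> apply List.count_eq_zero.1 <;>
    simp [hAB, hAB.symm] at hA hB ⊢ <;> omega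

theorem selfLinking_remove_two (h : β → ℤ) {A B : β} {x y z : List β} (hAB : h B = -h A)
    (hw : IsGaussWord (x ++ [A, B] ++ y ++ [B, A] ++ z)) :
    selfLinking h (x ++ [A, B] ++ y ++ [B, A] ++ z) = selfLinking h (x ++ y ++ z) := by
  obtain ⟨hne, hA, hB⟩ := notMem_of_remove_two hw
  have hS : (x ++ [A, B] ++ y ++ [B, A] ++ z).toFinset
      = insert A (insert B (x ++ y ++ z).toFinset) := by
    ext; simp; tauto
  have hnB : B ∉ (x ++ y ++ z).toFinset := by simpa using hB
  have hnA : A ∉ insert B (x ++ y ++ z).toFinset := by simpa [hne] using hA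
  have hnA' : A ∉ (x ++ y ++ z).toFinset := by simpa using hA
  simp only [List.mem_append, not_or] at hA hB
  set w := x ++ [A, B] ++ y ++ [B, A] ++ z with hwdef
  have hABi : interlace w A B = 0 := by
    apply interlace_eq_zero
    simp [hwdef, pairCount_append, pairCount_eq_zero_left, hA, hB, pairCount, hne, hne.symm,
      List.count_eq_zero_of_not_mem]
  have hBAi : interlace w B A = 0 := by
    apply interlace_eq_zero
    simp [hwdef, pairCount_append, pairCount_eq_zero_left, hA, hB, pairCount, hne, hne.symm,
      List.count_eq_zero_of_not_mem]
  have hE {E : β} (h₁ : A ≠ E) (h₂ : B ≠ E) : interlace w A E = interlace w B E := by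
    refine interlace_congr (by simp [h₁, h₂]) ?_
    simp [hwdef, pairCount_append, pairCount_eq_zero_left, hA, hB, pairCount, hne, hne.symm,
      List.count_eq_zero_of_not_mem, h₁, h₂]
  have hD {D : β} (h₁ : A ≠ D) (h₂ : B ≠ D) : interlace w D A = interlace w D B := by
    refine interlace_congr (by simp [h₁.symm, h₂.symm]) ?_
    simp [hwdef, pairCount_append, pairCount_eq_zero_right, hA, hB, pairCount, hne, hne.symm,
      List.count_eq_zero_of_not_mem, h₁, h₂]
  have hDE {D E : β} (h₁ : A ≠ D) (h₂ : B ≠ D) (h₃ : A ≠ E) (h₄ : B ≠ E) :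
      interlace w D E = interlace (x ++ y ++ z) D E := by
    refine interlace_congr Iff.rfl ?_
    simp [hwdef, pairCount_append, pairCount, h₁, h₂, h₃, h₄]
  have hne' {D : β} (hD : D ∈ (x ++ y ++ z).toFinset) : A ≠ D ∧ B ≠ D :=
    ⟨(ne_of_mem_of_not_mem hD hnA').symm, (ne_of_mem_of_not_mem hD hnB).symm⟩
  have hl {D : β} (h₁ : A ≠ D) (h₂ : B ≠ D) :
      linking h w D = linking h (x ++ y ++ z) D := by
    unfold linking
    rw [hS, Finset.sum_insert hnA, Finset.sum_insert hnB, hD h₁ h₂, hAB]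
    rw [Finset.sum_congr rfl fun E hE => by rw [hDE h₁ h₂ (hne' hE).1 (hne' hE).2]]
    ring
  have hlAB : linking h w A = linking h w B := by
    unfold linking
    rw [hS]
    simp only [Finset.sum_insert hnA, Finset.sum_insert hnB, hABi, hBAi, interlace_self]
    rw [Finset.sum_congr rfl fun E hE' => by rw [hE (hne' hE').1 (hne' hE').2]]
  unfold selfLinking
  rw [hS, Finset.sum_insert hnA, Finset.sum_insert hnB, hlAB, hAB]
  rw [Finset.sum_congr rfl fun D hD => by rw [hl (hne' hD).1 (hne' hD).2]]
  ring

theorem selfLinking_swap_three (h : β → ℤ) {A B C : β} {x y z t : List β}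
    (hAB : h A = h B) (hBC : h B = h C)
    (hw : IsGaussWord (x ++ [A, B] ++ y ++ [A, C] ++ z ++ [B, C] ++ t)) :
    selfLinking h (x ++ [A, B] ++ y ++ [A, C] ++ z ++ [B, C] ++ t)
      = selfLinking h (x ++ [B, A] ++ y ++ [C, A] ++ z ++ [C, B] ++ t) := by
  have hcA := hw A (by simp)
  have hcB := hw B (by simp)
  have hcC := hw C (by simp)
  have nAB : A ≠ B := by
    rintro rfl
    simp [List.count_cons] at hcA
    omega
  have nAC : A ≠ C := by
    rintro rfl
    simp [List.count_cons] at hcA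
    omega
  have nBC : B ≠ C := by
    rintro rfl
    simp [List.count_cons] at hcB
    omega
  have nBA := nAB.symm
  have nCA := nAC.symm
  have nCB := nBC.symm
  have hA : A ∉ x ∧ A ∉ y ∧ A ∉ z ∧ A ∉ t := by
    simp only [← List.count_eq_zero]
    simp [nBA, nCA] at hcA
    omega
  have hB : B ∉ x ∧ B ∉ y ∧ B ∉ z ∧ B ∉ t := by
    simp only [← List.count_eq_zero]
    simp [nAB, nCB] at hcB
    omega
  have hC : C ∉ x ∧ C ∉ y ∧ C ∉ z ∧ C ∉ t := by
    simp only [← List.count_eq_zero]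
    simp [nAC, nBC] at hcC
    omega
  set R := (x ++ y ++ z ++ t).toFinset with hR
  have hnC : C ∉ R := by simp [hR, hC]
  have hnB : B ∉ insert C R := by simp [hR, hB, nBC]
  have hnA : A ∉ insert B (insert C R) := by simp [hR, hA, nAB, nAC]
  have hne {D : β} (hD : D ∈ R) : A ≠ D ∧ B ≠ D ∧ C ≠ D := by
    refine ⟨?_, ?_, ?_⟩ <;> rintro rfl <;> simp_all
  set w := x ++ [A, B] ++ y ++ [A, C] ++ z ++ [B, C] ++ t with hwdef
  set w' := x ++ [B, A] ++ y ++ [C, A] ++ z ++ [C, B] ++ t with hwdef'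
  have hS : w.toFinset = insert A (insert B (insert C R)) := by
    ext; simp only [hwdef, hR, List.mem_toFinset, List.mem_append, List.mem_cons,
      List.not_mem_nil, Finset.mem_insert]; grind
  have hS' : w'.toFinset = insert A (insert B (insert C R)) := by
    ext; simp only [hwdef', hR, List.mem_toFinset, List.mem_append, List.mem_cons,
      List.not_mem_nil, Finset.mem_insert]; grind
  have hD {D E : β} (h₁ : A ≠ D) (h₂ : B ≠ D) (h₃ : C ≠ D) :
      interlace w D E = interlace w' D E := by
    refine interlace_congr Iff.rfl ?_
    simp [hwdef, hwdef', pairCount_append, pairCount, h₁, h₂, h₃, List.count_cons]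
    ring
  have hE {D E : β} (h₁ : A ≠ E) (h₂ : B ≠ E) (h₃ : C ≠ E) :
      interlace w D E = interlace w' D E := by
    refine interlace_congr Iff.rfl ?_
    simp [hwdef, hwdef', pairCount_append, pairCount, h₁, h₂, h₃]
    ring
  have iAB : interlace w A B = 1 ∧ interlace w' A B = 0 := by
    constructor <;> simp [interlace, hwdef, hwdef', pairCount_append, pairCount, hA, hB,
      pairCount_eq_zero_left, List.count_eq_zero_of_not_mem, nAB, nAC, nBA, nCA, nBC, nCB]
  have iAC : interlace w A C = 0 ∧ interlace w' A C = 1 := by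
    constructor <;> simp [interlace, hwdef, hwdef', pairCount_append, pairCount, hA, hC,
      pairCount_eq_zero_left, List.count_eq_zero_of_not_mem, nAB, nAC, nBA, nCA, nBC, nCB]
  have iBC : interlace w B C = 1 ∧ interlace w' B C = 0 := by
    constructor <;> simp [interlace, hwdef, hwdef', pairCount_append, pairCount, hB, hC,
      pairCount_eq_zero_left, List.count_eq_zero_of_not_mem, nAB, nAC, nBC, nCB]
  have iBA : interlace w B A = -1 ∧ interlace w' B A = 0 := by
    constructor <;> simp [interlace, hwdef, hwdef', pairCount_append, pairCount, hA, hB,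
      pairCount_eq_zero_left, List.count_eq_zero_of_not_mem, nAB, nAC, nBA, nCA, nCB]
  have iCA : interlace w C A = 0 ∧ interlace w' C A = -1 := by
    constructor <;> simp [interlace, hwdef, hwdef', pairCount_append, pairCount, hA, hC,
      pairCount_eq_zero_left, List.count_eq_zero_of_not_mem, nAB, nAC, nBA, nCA, nBC]
  have iCB : interlace w C B = -1 ∧ interlace w' C B = 0 := by
    constructor <;> simp [interlace, hwdef, hwdef', pairCount_append, pairCount, hB, hC,
      pairCount_eq_zero_left, List.count_eq_zero_of_not_mem, nAB, nAC, nBC, nCB]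
  have hsum (D : β) : ∑ E ∈ R, h E * interlace w D E = ∑ E ∈ R, h E * interlace w' D E :=
    Finset.sum_congr rfl fun E hE' => by rw [hE (hne hE').1 (hne hE').2.1 (hne hE').2.2]
  have hl {D : β} (hD' : D ∈ insert A (insert B (insert C R))) :
      linking h w D = linking h w' D := by
    unfold linking
    rw [hS, hS']
    simp only [Finset.sum_insert hnA, Finset.sum_insert hnB, Finset.sum_insert hnC, hsum]
    simp only [Finset.mem_insert] at hD'
    rcases hD' with rfl | rfl | rfl | hD'
    · simp [iAB, iAC, hBC]
    · simp [iBA, iBC, hAB, hBC]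
    · simp [iCA, iCB, hAB]
    · simp only [hD (hne hD').1 (hne hD').2.1 (hne hD').2.2]
  unfold selfLinking
  rw [hS, hS']
  exact Finset.sum_congr rfl fun D hD' => by rw [hl hD']

theorem selfLinking_triple (h : β → ℤ) {A B C : β} (hAB : A ≠ B) (hAC : A ≠ C) (hBC : B ≠ C)
    (hA : h A = 1) (hB : h B = 1) (hC : h C = 1) :
    selfLinking h [A, B, A, C, B, C] = 2 := by
  have hS : [A, B, A, C, B, C].toFinset = {A, B, C} := by ext; simp
  have hA' : A ∉ ({B, C} : Finset β) := by simp [hAB, hAC]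
  have hB' : B ∉ ({C} : Finset β) := by simp [hBC]
  simp only [selfLinking, linking, hS, Finset.sum_insert hA', Finset.sum_insert hB',
    Finset.sum_singleton, hA, hB, hC]
  simp [interlace, pairCount, hAB, hAC, hBC, hAB.symm, hAC.symm, hBC.symm]

/-- The parity of the number of occurrences of `A` in the left part of a two-part word, whose
letters are tagged by whether they lie in the left part. -/
def leftParity (W : List (Bool × β)) (A : β) : ZMod 2 := (W.count (true, A) : ℕ)

/-- The parity of the length of the left part of `W`, plus that of the number of pairs consisting
of an occurrence of a letter shared by the two parts followed by one of a letter not shared. -/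
def sharing (W : List (Bool × β)) : ZMod 2 :=
  (W.countP Prod.fst : ℕ) + inversions (leftParity W) (W.map Prod.snd)

theorem sharing_map {γ : Type*} [DecidableEq γ] {g : β → γ} (hg : Function.Injective g)
    (W : List (Bool × β)) : sharing (W.map (Prod.map id g)) = sharing W := by
  have h (A : β) : leftParity (W.map (Prod.map id g)) (g A) = leftParity W A := by
    have := List.count_map_of_injective W _ (Function.injective_id.prodMap hg) (true, A)
    simpa [leftParity] using congrArg (Nat.cast : ℕ → ZMod 2) this
  have h' : (W.map (Prod.map id g)).map Prod.snd = (W.map Prod.snd).map g := by simp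
  have h'' : (W.map (Prod.map id g)).countP Prod.fst = W.countP Prod.fst := by
    rw [List.countP_map]; rfl
  rw [sharing, sharing, h', inversions_map, h'']
  congr 1
  exact inversions_congr fun A _ => h A

theorem sharing_remove_one (b : Bool) (A : β) (X Y : List (Bool × β)) :
    sharing (X ++ [(b, A), (b, A)] ++ Y) = sharing (X ++ Y) := by
  have h2 : (2 : ZMod 2) = 0 := rfl
  have h : leftParity (X ++ [(b, A), (b, A)] ++ Y) = leftParity (X ++ Y) := by
    funext E
    simp only [leftParity, List.count_append, List.count_cons, List.count_nil]
    push_cast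
    linear_combination (if (b, A) == (true, E) then 1 else 0) * h2
  have h3 : ∀ s : ZMod 2, s * (1 - s) = 0 := by decide
  simp only [sharing, h]
  generalize leftParity (X ++ Y) = s
  simp only [List.map_append, List.map_cons, List.map_nil, inversions_append, inversions,
    List.sum_append, List.sum_cons, List.sum_nil, List.countP_append, List.countP_cons,
    List.countP_nil]
  push_cast
  linear_combination h3 (s A) + ((if b = true then 1 else 0)
    + ((X.map Prod.snd).map s).sum * (1 - s A)
    + s A * ((Y.map Prod.snd).map fun E => 1 - s E).sum) * h2

theorem sharing_remove_two {b b' : Bool} {A B : β} {X Y Z : List (Bool × β)} (hne : A ≠ B)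
    (hA : A ∉ (X ++ Y ++ Z).map Prod.snd) (hB : B ∉ (X ++ Y ++ Z).map Prod.snd) :
    sharing (X ++ [(b, A), (b, B)] ++ Y ++ [(b', B), (b', A)] ++ Z)
      = sharing (X ++ Y ++ Z) := by
  have h2 : (2 : ZMod 2) = 0 := rfl
  set W := X ++ [(b, A), (b, B)] ++ Y ++ [(b', B), (b', A)] ++ Z with hW
  have hc (c : Bool) (D : β) (hD : D ∉ (X ++ Y ++ Z).map Prod.snd) :
      X.count (c, D) = 0 ∧ Y.count (c, D) = 0 ∧ Z.count (c, D) = 0 := by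
    simp only [List.map_append, List.mem_append, List.mem_map, not_or, not_exists] at hD
    refine ⟨?_, ?_, ?_⟩ <;> rw [List.count_eq_zero] <;> intro hm
    · exact hD.1.1 _ ⟨hm, rfl⟩
    · exact hD.1.2 _ ⟨hm, rfl⟩
    · exact hD.2 _ ⟨hm, rfl⟩
  have hAB : leftParity W A = leftParity W B := by
    simp [leftParity, hW, List.count_cons, hc true A hA, hc true B hB, hne, hne.symm, add_comm]
  have hcong : inversions (leftParity (X ++ Y ++ Z)) ((X ++ Y ++ Z).map Prod.snd)
      = inversions (leftParity W) ((X ++ Y ++ Z).map Prod.snd) := by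
    refine inversions_congr fun E hE => ?_
    have h₁ : A ≠ E := (ne_of_mem_of_not_mem hE hA).symm
    have h₂ : B ≠ E := (ne_of_mem_of_not_mem hE hB).symm
    simp [leftParity, hW, h₁, h₂]
  have h3 : ∀ s : ZMod 2, s * (1 - s) = 0 := by decide
  rw [sharing, sharing, hcong]
  generalize leftParity W = s at *
  simp only [hW, List.map_append, List.map_cons, List.map_nil, inversions_append, inversions,
    List.sum_append, List.sum_cons, List.sum_nil, List.countP_append, List.countP_cons,
    List.countP_nil, hAB]
  push_cast
  linear_combination ((if b = true then 1 else 0) + (if b' = true then 1 else 0)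
    + 2 * ((X.map Prod.snd).map s).sum * (1 - s B)
    + ((Y.map Prod.snd).map s).sum * (1 - s B)
    + s B * ((Y.map Prod.snd).map fun E => 1 - s E).sum
    + 2 * s B * ((Z.map Prod.snd).map fun E => 1 - s E).sum + 3 * s B * (1 - s B)) * h2

theorem sharing_swap_three (b b' b'' : Bool) (A B C : β) (X Y Z T : List (Bool × β)) :
    sharing (X ++ [(b, A), (b, B)] ++ Y ++ [(b', A), (b', C)] ++ Z ++ [(b'', B), (b'', C)] ++ T)
      = sharing (X ++ [(b, B), (b, A)] ++ Y ++ [(b', C), (b', A)] ++ Z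
        ++ [(b'', C), (b'', B)] ++ T) := by
  have h2 : (2 : ZMod 2) = 0 := rfl
  have h : leftParity (X ++ [(b, A), (b, B)] ++ Y ++ [(b', A), (b', C)] ++ Z
        ++ [(b'', B), (b'', C)] ++ T)
      = leftParity (X ++ [(b, B), (b, A)] ++ Y ++ [(b', C), (b', A)] ++ Z
        ++ [(b'', C), (b'', B)] ++ T) := by
    funext E
    simp only [leftParity, List.count_append, List.count_cons, List.count_nil]
    push_cast
    ring
  simp only [sharing, h]
  generalize leftParity (_ : List (Bool × β)) = s
  simp only [List.map_append, List.map_cons, List.map_nil, inversions_append, inversions,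
    List.sum_append, List.sum_cons, List.sum_nil, List.countP_append, List.countP_cons,
    List.countP_nil]
  push_cast
  linear_combination (s A - s C) * h2

end Words

/-- The letters of a flattened phrase, each tagged by whether it precedes the `c`-th separator. -/
def tagged : ℕ → List (Option (Letter α)) → List (Bool × Letter α)
  | _, [] => []
  | c, none :: L => tagged (c - 1) L
  | c, some A :: L => (decide (0 < c), A) :: tagged c L

theorem tagged_append (c : ℕ) (u v : List (Option (Letter α))) :
    tagged c (u ++ v) = tagged c u ++ tagged (c - u.countP Option.isNone) v := by
  induction u generalizing c with
  | nil => rfl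
  | cons o u ih => cases o <;> simp [tagged, ih, Nat.sub_sub, add_comm]

theorem tagged_map_some_append (c : ℕ) (w : List (Letter α)) (L : List (Option (Letter α))) :
    tagged c (w.map some ++ L) = w.map (Prod.mk (decide (0 < c))) ++ tagged c L := by
  induction w with
  | nil => rfl
  | cons A w ih => simp [tagged, ih]

theorem tagged_map (c : ℕ) (g : Letter α → Letter α) (L : List (Option (Letter α))) :
    tagged c (L.map (Option.map g)) = (tagged c L).map (Prod.map id g) := by
  induction L generalizing c with
  | nil => rfl
  | cons o L ih => cases o <;> simp [tagged, ih]

theorem map_snd_tagged (c : ℕ) (L : List (Option (Letter α))) :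
    (tagged c L).map Prod.snd = L.reduceOption := by
  induction L generalizing c with
  | nil => rfl
  | cons o L ih => cases o <;> simp [tagged, ih]

theorem flat_cons_cons (v w : List (Letter α)) (P : Phrase α) :
    flat (v :: w :: P) = v.map some ++ none :: flat (w :: P) := by
  simp [flat, List.intercalate]

theorem flat_map (g : Letter α → Letter α) (P : Phrase α) :
    flat (P.map (List.map g)) = (flat P).map (Option.map g) := by
  induction P with
  | nil => rfl
  | cons w P ih =>
    cases P with
    | nil => simp [flat]
    | cons v P => simpa [flat_cons_cons] using ih

theorem tagged_flat_cons (c : ℕ) (w : List (Letter α)) (P : Phrase α) :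
    tagged c (flat (w :: P)) = w.map (Prod.mk (decide (0 < c))) ++ tagged (c - 1) (flat P) := by
  cases P with
  | nil => simpa [flat, tagged] using tagged_map_some_append c w []
  | cons v P =>
    rw [flat_cons_cons, tagged_map_some_append, tagged]

theorem tagged_flat (c : ℕ) (P : Phrase α) :
    tagged c (flat P) = (P.take c).flatten.map (Prod.mk true)
      ++ (P.drop c).flatten.map (Prod.mk false) := by
  induction P generalizing c with
  | nil => simp [flat, tagged]
  | cons w P ih =>
    rw [tagged_flat_cons, ih]
    cases c <;> simp

theorem reduceOption_flat (P : Phrase α) : (flat P).reduceOption = P.flatten := by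
  simpa using (map_snd_tagged 0 (flat P)).symm.trans (by simp [tagged_flat, Function.comp_def])

section Invariance

variable [DecidableEq α] {τ : α → α}

theorem IsGauss.isGaussWord {P : Phrase α} (hP : IsGauss P) :
    IsGaussWord (flat P).reduceOption := by
  intro A hA
  rw [reduceOption_flat] at hA ⊢
  convert hP A hA

theorem Move.sharing_eq {P Q : Phrase α} (hm : Move τ P Q) (hP : IsGauss P) (c : ℕ) :
    sharing (tagged c (flat P)) = sharing (tagged c (flat Q)) := by
  cases hm with
  | iso f hf =>
    have hg : Function.Injective fun A : Letter α => (f A.1, A.2) :=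
      hf.prodMap Function.injective_id
    rw [rename, flat_map, tagged_map, sharing_map hg]
  | h1 _ _ A x y hp hq =>
    rw [hp, hq]
    simp only [tagged_append, List.countP_append, List.countP_cons, List.countP_nil, tagged,
      Option.isNone_some, Bool.false_eq_true, if_false, add_zero]
    exact sharing_remove_one _ A _ _
  | h2 _ _ A B x y z hAB hp hq =>
    have hc := hP.isGaussWord
    rw [hp] at hc ⊢
    rw [hq]
    simp only [List.reduceOption_append] at hc
    obtain ⟨hne, hA, hB⟩ := notMem_of_remove_two hc
    simp only [tagged_append, List.countP_append, List.countP_cons, List.countP_nil, tagged,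
      Option.isNone_some, Bool.false_eq_true, if_false, add_zero]
    apply sharing_remove_two hne <;> simpa only [List.map_append, map_snd_tagged]
  | h3 _ _ A B C x y z t hAB hBC hp hq =>
    rw [hp, hq]
    simp only [tagged_append, List.countP_append, List.countP_cons, List.countP_nil, tagged,
      Option.isNone_some, Bool.false_eq_true, if_false, add_zero]
    exact sharing_swap_three _ _ _ A B C _ _ _ _

theorem Move.selfLinking_eq {P Q : Phrase α} (hm : Move τ P Q) (hP : IsGauss P) {h : α → ℤ}
    (hh : ∀ a, h (τ a) = -h a) :
    selfLinking (fun A : Letter α => h A.2) P.flatten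
      = selfLinking (fun A : Letter α => h A.2) Q.flatten := by
  have hc := hP.isGaussWord
  cases hm with
  | iso f hf =>
    have hg : Function.Injective fun A : Letter α => (f A.1, A.2) :=
      hf.prodMap Function.injective_id
    rw [rename, ← List.map_flatten, selfLinking_map hg]
    rfl
  | h1 _ _ A x y hp hq =>
    rw [← reduceOption_flat, ← reduceOption_flat, hq]
    rw [hp] at hc ⊢
    simp only [List.reduceOption_append] at hc ⊢
    exact selfLinking_remove_one _ hc
  | h2 _ _ A B x y z hAB hp hq =>
    rw [← reduceOption_flat, ← reduceOption_flat, hq]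
    rw [hp] at hc ⊢
    simp only [List.reduceOption_append] at hc ⊢
    exact selfLinking_remove_two _ (by rw [hAB, hh]) hc
  | h3 _ _ A B C x y z t hAB hBC hp hq =>
    rw [← reduceOption_flat, ← reduceOption_flat, hq]
    rw [hp] at hc ⊢
    simp only [List.reduceOption_append] at hc ⊢
    exact selfLinking_swap_three _ (by rw [hAB]) (by rw [hBC]) hc

theorem Homotopic.eq_of_move {γ : Type*} {I : Phrase α → γ}
    (hI : ∀ P Q, Move τ P Q → IsGauss P → I P = I Q) {P Q : Phrase α} (h : Homotopic τ P Q) :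
    I P = I Q := by
  induction h with
  | refl => rfl
  | tail _ h ih =>
    obtain ⟨h | h, hX, hY⟩ := h
    · exact ih.trans (hI _ _ h hX.1)
    · exact ih.trans (hI _ _ h hY.1).symm

theorem desingWord_append (m : Letter α → ℕ) (u v : List (Letter α)) (seen : Letter α → ℕ) :
    desingWord m (u ++ v) seen
      = desingWord m u seen ++ desingWord m v (fun B => seen B + u.count B) := by
  induction u generalizing seen with
  | nil => simp [desingWord]
  | cons A u ih =>
    simp only [List.cons_append, desingWord, ih, List.append_assoc]
    congr 3
    funext B
    by_cases h : B = A
    · simp [h]; omega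
    · simp [h, Ne.symm h]

theorem flatten_take_desingAux (m : Letter α → ℕ) (P : Phrase α) (seen : Letter α → ℕ) (c : ℕ) :
    ((desingAux m P seen).take c).flatten = desingWord m (P.take c).flatten seen := by
  induction P generalizing c seen with
  | nil => simp [desingAux, desingWord]
  | cons w P ih =>
    cases c
    · simp [desingWord]
    · simp [desingAux, desingWord_append, ih]

theorem flatten_drop_desingAux (m : Letter α → ℕ) (P : Phrase α) (seen : Letter α → ℕ) (c : ℕ) :
    ((desingAux m P seen).drop c).flatten
      = desingWord m (P.drop c).flatten (fun B => seen B + (P.take c).flatten.count B) := by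
  induction P generalizing c seen with
  | nil => simp [desingAux, desingWord]
  | cons w P ih =>
    cases c with
    | zero => simpa [desingAux, desingWord_append] using ih (fun B => seen B + w.count B) 0
    | succ c => simp [desingAux, ih, add_assoc]

/-- The desingularization of the two-part phrase with `p` copies of `A` in the left part and `q`
copies in the right part, as a tagged word. -/
def powerDesing (A : Letter α) (p q : ℕ) : List (Bool × Letter α) :=
  (desingWord (fun B => (List.replicate (p + q) A).count B) (List.replicate p A)
      (fun _ => 0)).map (Prod.mk true)
    ++ (desingWord (fun B => (List.replicate (p + q) A).count B) (List.replicate q A)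
      (fun B => (List.replicate p A).count B)).map (Prod.mk false)

theorem tagged_flat_desing {k : ℕ} {f : Fin k → List (Letter α)} {A : Letter α}
    (hf : ∀ i, ∀ B ∈ f i, B = A) (c p q : ℕ) (hp : ∑ i with i.val < c, (f i).length = p)
    (hpq : ∑ i, (f i).length = p + q) :
    tagged c (flat (desing (List.ofFn f))) = powerDesing A p q := by
  have hall : ∀ B ∈ (List.ofFn f).flatten, B = A := by simpa using fun B i => hf i B
  have htake : ((List.ofFn f).take c).flatten = List.replicate p A := by
    refine List.eq_replicate_iff.2 ⟨?_, fun B hB => hall B ?_⟩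
    · rw [List.length_flatten, List.map_take, List.map_ofFn, List.sum_take_ofFn]
      exact hp
    · exact ((List.take_sublist c _).flatten).subset hB
  have htot : (List.ofFn f).flatten = List.replicate (p + q) A := by
    refine List.eq_replicate_iff.2 ⟨?_, hall⟩
    rw [List.length_flatten, List.map_ofFn, List.sum_ofFn]
    exact hpq
  have hdrop : ((List.ofFn f).drop c).flatten = List.replicate q A := by
    have := htot
    rw [← List.take_append_drop c (List.ofFn f), List.flatten_append, htake,
      List.replicate_add] at this
    exact List.append_cancel_left this
  rw [tagged_flat, desing, flatten_take_desingAux, flatten_drop_desingAux, htake, hdrop, htot]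
  simp [powerDesing]

theorem tagged_flat_desing_emptyP (k c : ℕ) :
    tagged c (flat (desing (emptyP k : Phrase α))) = [] := by
  rw [tagged_flat, desing, flatten_take_desingAux, flatten_drop_desingAux]
  simp [emptyP, desingWord]

theorem sharing_powerDesing_one_one (a : α) : sharing (powerDesing (ofα a) 1 1) = 1 := by
  simp [powerDesing, desingWord, repl, List.range_succ, sharing, inversions, leftParity]

theorem sharing_powerDesing_two_one (a : α) : sharing (powerDesing (ofα a) 2 1) = 1 := by
  simp [powerDesing, desingWord, repl, List.range_succ, sharing, inversions, leftParity,
    List.replicate_succ, dLetter, List.count_cons]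
  rfl

theorem sharing_powerDesing_one_two (a : α) : sharing (powerDesing (ofα a) 1 2) = 1 := by
  simp [powerDesing, desingWord, repl, List.range_succ, sharing, inversions, leftParity,
    List.replicate_succ, dLetter, List.count_cons]
  rfl

theorem selfLinking_powerDesing_three {h : α → ℤ} {a : α} (ha : h a = 1) :
    selfLinking (fun A : Letter α => h A.2) ((powerDesing (ofα a) 0 3).map Prod.snd) = 2 := by
  have : (powerDesing (ofα a) 0 3).map Prod.snd
      = [dLetter (ofα a) 1 2, dLetter (ofα a) 1 3, dLetter (ofα a) 1 2, dLetter (ofα a) 2 3,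
        dLetter (ofα a) 1 3, dLetter (ofα a) 2 3] := by
    simp [powerDesing, desingWord, repl, List.range_succ, List.replicate_succ]
  rw [this]
  apply selfLinking_triple <;> simp [dLetter, ofα, ha]

theorem not_eHomotopic_emptyP_of_sharing {P : Phrase α} {k : ℕ} (c : ℕ)
    (h : sharing (tagged c (flat (desing P))) = 1) : ¬ EHomotopic τ P (emptyP k) := by
  intro he
  have := he.eq_of_move (I := fun X => sharing (tagged c (flat X)))
    fun X Y hm hX => hm.sharing_eq hX c
  simp only [h, tagged_flat_desing_emptyP] at this
  simp [sharing, inversions] at this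

end Invariance

/-- **Lemma 4.5** of the paper: none of the étale phrases `P^{1,1;l₁,l₂}_a`,
`P^{3;l}_a` (with `a ≠ τ(a)`), `P^{2,1;l₁,l₂}_a`, `P^{1,2;l₁,l₂}_a`,
`P^{1,1,1;l₁,l₂,l₃}_a` is homotopic to the empty phrase `(∅)_k`. -/
theorem model_phrases_not_contractible
    {α : Type*} [Fintype α] [DecidableEq α] (τ : α → α) (hτ : Function.Involutive τ)
    (k : ℕ) (M : Model k α) (hM : M.valid τ) :
    ¬ EHomotopic τ M.toPhrase (emptyP k) := by
  cases M with
  | m11 l1 l2 a =>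
    simp only [Model.valid] at hM
    refine not_eHomotopic_emptyP_of_sharing (l1 + 1) ?_
    have hlen (i : Fin k) : (if i = l1 ∨ i = l2 then [ofα a] else []).length
        = (if i = l1 then 1 else 0) + if i = l2 then 1 else 0 := by
      split_ifs <;> grind
    rw [Model.toPhrase, P11, tagged_flat_desing (A := ofα a) (p := 1) (q := 1)]
    · exact sharing_powerDesing_one_one a
    · intro i B
      split_ifs <;> simp
    · simp only [hlen, Finset.sum_add_distrib, Finset.sum_ite_eq']
      simp; omega
    · simp [hlen, Finset.sum_add_distrib]
  | m3 l a =>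
    simp only [Model.valid] at hM
    intro he
    set h : α → ℤ := fun b => (if b = a then 1 else 0) - if b = τ a then 1 else 0 with hdef
    have hh (b : α) : h (τ b) = -h b := by
      simp [hdef, hτ.injective.eq_iff, hτ.eq_iff]
    have := he.eq_of_move (I := fun X => selfLinking (fun A : Letter α => h A.2) X.flatten)
      fun X Y hm hX => hm.selfLinking_eq hX hh
    have hlen (i : Fin k) : (if i = l then [ofα a, ofα a, ofα a] else []).length
        = if i = l then 3 else 0 := by
      split_ifs <;> rfl
    simp only [← reduceOption_flat, ← map_snd_tagged 0] at this
    rw [tagged_flat_desing_emptyP, Model.toPhrase, P3,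
      tagged_flat_desing (A := ofα a) (p := 0) (q := 3),
      selfLinking_powerDesing_three (by simp [hdef, hM])] at this
    · simp [selfLinking] at this
    · intro i B
      split_ifs <;> simp
    · simp
    · simp [hlen]
  | m21 l1 l2 a =>
    simp only [Model.valid] at hM
    refine not_eHomotopic_emptyP_of_sharing (l1 + 1) ?_
    have hlen (i : Fin k) : (if i = l1 then [ofα a, ofα a] else
        if i = l2 then [ofα a] else []).length = (if i = l1 then 2 else 0) + if i = l2 then 1 else 0 := by
      split_ifs <;> grind
    rw [Model.toPhrase, P21, tagged_flat_desing (A := ofα a) (p := 2) (q := 1)]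
    · exact sharing_powerDesing_two_one a
    · intro i B
      split_ifs <;> simp
    · simp only [hlen, Finset.sum_add_distrib, Finset.sum_ite_eq']
      simp; omega
    · simp [hlen, Finset.sum_add_distrib]
  | m12 l1 l2 a =>
    simp only [Model.valid] at hM
    refine not_eHomotopic_emptyP_of_sharing (l1 + 1) ?_
    have hlen (i : Fin k) : (if i = l1 then [ofα a] else
        if i = l2 then [ofα a, ofα a] else []).length = (if i = l1 then 1 else 0) + if i = l2 then 2 else 0 := by
      split_ifs <;> grind
    rw [Model.toPhrase, P12, tagged_flat_desing (A := ofα a) (p := 1) (q := 2)]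
    · exact sharing_powerDesing_one_two a
    · intro i B
      split_ifs <;> simp
    · simp only [hlen, Finset.sum_add_distrib, Finset.sum_ite_eq']
      simp; omega
    · simp [hlen, Finset.sum_add_distrib]
  | m111 l1 l2 l3 a =>
    simp only [Model.valid] at hM
    refine not_eHomotopic_emptyP_of_sharing (l1 + 1) ?_
    have hlen (i : Fin k) : (if i = l1 ∨ i = l2 ∨ i = l3 then [ofα a] else []).length
        = (if i = l1 then 1 else 0) + ((if i = l2 then 1 else 0) + if i = l3 then 1 else 0) := by
      split_ifs <;> grind
    rw [Model.toPhrase, P111, tagged_flat_desing (A := ofα a) (p := 1) (q := 2)]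
    · exact sharing_powerDesing_one_two a
    · intro i B
      split_ifs <;> simp
    · simp only [hlen, Finset.sum_add_distrib, Finset.sum_ite_eq']
      simp; omega
    · simp [hlen, Finset.sum_add_distrib]

end Nano
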